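/- arXiv:1305.7112 — 2 statements merged into one kernel-verified Lean document; each statement's English description precedes it below -/
import Mathlib

section
/- Let k > 0 be an integer and let G be a finite simple graph. If tw(G) ≥ 36k − 5/2 (equivalently tw(G) ≥ 36k − 2, since treewidth is an integer), then G contains the wheel W_k as a minor. -/
/-- `IsMinor H G` : there is a minor model of `H` in `G`, i.e. a family of pairwise
disjoint vertex sets of `G`, each inducing a connected subgraph, one for each vertex
of `H`, such that every edge of `H` is realized by an edge of `G` between the
corresponding sets. -/
def IsMinor {α : Type*} {β : Type*} (H : SimpleGraph α) (G : SimpleGraph β) : Prop :=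
  ∃ M : α → Set β,
    (∀ v, (G.induce (M v)).Connected) ∧
    (Pairwise fun u v => Disjoint (M u) (M v)) ∧
    (∀ ⦃u v : α⦄, H.Adj u v → ∃ a ∈ M u, ∃ b ∈ M v, G.Adj a b)

/-- The treewidth of a finite simple graph: the least `w` such that `G` admits a tree
decomposition all of whose bags have at most `w + 1` vertices. -/
noncomputable def treewidth {V : Type*} [Fintype V] (G : SimpleGraph V) : ℕ :=
  sInf { w : ℕ | ∃ (ι : Type) (_ : Fintype ι) (t : SimpleGraph ι) (bag : ι → Finset V),
    t.IsTree ∧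
    (∀ v : V, ∃ i, v ∈ bag i) ∧
    (∀ u v : V, G.Adj u v → ∃ i, u ∈ bag i ∧ v ∈ bag i) ∧
    (∀ v : V, (t.induce {i : ι | v ∈ bag i}).Connected) ∧
    (∀ i, (bag i).card ≤ w + 1) }

/-- The wheel of order `r` : a cycle `w_1 … w_r` (the `some` vertices) together with a
hub `o` (the vertex `none`) adjacent to every cycle vertex. -/
def wheel (r : ℕ) : SimpleGraph (Option (Fin r)) :=
  SimpleGraph.fromRel (fun u v =>
    match u, v with
    | none, some _ => True
    | some i, some j => (j : ℕ) = ((i : ℕ) + 1) % r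
    | _, _ => False)

namespace SimpleGraph

variable {V : Type*} {G : SimpleGraph V} {A B C S T W Y Z : Set V} {a b c s t x y : V}

/-- Some edge of `G` joins a vertex of `S` to a vertex of `T`. -/
def Touches (G : SimpleGraph V) (S T : Set V) : Prop := ∃ x ∈ S, ∃ y ∈ T, G.Adj x y

lemma Touches.symm (h : G.Touches S T) : G.Touches T S :=
  let ⟨x, hx, y, hy, e⟩ := h
  ⟨y, hy, x, hx, e.symm⟩

lemma Touches.mono (h : G.Touches S T) (hS : S ⊆ A) (hT : T ⊆ B) : G.Touches A B :=
  let ⟨x, hx, y, hy, e⟩ := h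
  ⟨x, hS hx, y, hT hy, e⟩

lemma induce_singleton_connected (x : V) : (G.induce {x}).Connected where
  preconnected := fun u v => by
    have : u = v := Subsingleton.elim u v
    exact this ▸ Reachable.refl _
  nonempty := ⟨⟨x, rfl⟩⟩

lemma Touches.union_connected (h : G.Touches S T) (hS : (G.induce S).Connected)
    (hT : (G.induce T).Connected) : (G.induce (S ∪ T)).Connected :=
  let ⟨_, hx, _, hy, e⟩ := h
  connected_induce_union hS.preconnected hT.preconnected hx hy e

lemma insert_connected (hS : (G.induce S).Connected) (h : G.Touches S {x}) :
    (G.induce (insert x S)).Connected := by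
  rw [Set.insert_eq, Set.union_comm]
  exact h.union_connected hS (induce_singleton_connected x)

/-- A connected set that meets `K` and is not contained in it has an edge leaving `K`. -/
lemma exists_adj_of_connected {K : Set V} (hC : (G.induce C).Connected) (hx : x ∈ C) (hxK : x ∈ K)
    (hy : y ∈ C) (hyK : y ∉ K) : ∃ u ∈ C, ∃ v ∈ C, u ∈ K ∧ v ∉ K ∧ G.Adj u v := by
  obtain ⟨p⟩ := hC.preconnected ⟨x, hx⟩ ⟨y, hy⟩
  obtain ⟨d, -, h1, h2⟩ := p.exists_boundary_dart {z | (z : V) ∈ K} hxK hyK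
  exact ⟨d.fst, d.fst.2, d.snd, d.snd.2, h1, h2, d.adj⟩

/-- The connected component of `b` in the subgraph induced by `Y` (empty if `b ∉ Y`). -/
def componentIn (G : SimpleGraph V) (Y : Set V) (b : V) : Set V :=
  ⋃₀ {C | C ⊆ Y ∧ b ∈ C ∧ (G.induce C).Connected}

lemma subset_componentIn (hC : (G.induce C).Connected) (hCY : C ⊆ Y) (hb : b ∈ C) :
    C ⊆ G.componentIn Y b :=
  Set.subset_sUnion_of_mem ⟨hCY, hb, hC⟩

lemma componentIn_subset : G.componentIn Y b ⊆ Y :=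
  Set.sUnion_subset fun _ h => h.1

lemma mem_componentIn_self (hb : b ∈ Y) : b ∈ G.componentIn Y b :=
  subset_componentIn (induce_singleton_connected b) (by simpa using hb) rfl rfl

lemma componentIn_connected (hb : b ∈ Y) : (G.induce (G.componentIn Y b)).Connected :=
  induce_sUnion_connected_of_pairwise_not_disjoint
    ⟨{b}, by simpa using hb, rfl, induce_singleton_connected b⟩
    (fun hs ht => ⟨b, hs.2.1, ht.2.1⟩) (fun hs => hs.2.2)

lemma mem_componentIn_of_adj (hx : x ∈ G.componentIn Y b) (hy : y ∈ Y) (h : G.Adj x y) :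
    y ∈ G.componentIn Y b := by
  obtain ⟨C, ⟨hCY, hb, hC⟩, hxC⟩ := hx
  have h1 : (G.induce (insert y C)).Connected := insert_connected hC ⟨x, hxC, y, rfl, h⟩
  exact subset_componentIn h1 (Set.insert_subset hy hCY) (Set.mem_insert_of_mem _ hb)
    (Set.mem_insert _ _)

lemma disjoint_componentIn (h : x ∉ G.componentIn Y b) :
    Disjoint (G.componentIn Y x) (G.componentIn Y b) := by
  refine Set.disjoint_left.2 fun y ⟨C, ⟨hCY, hxC, hC⟩, hyC⟩ hy => ?_
  obtain ⟨u, -, v, hv, hu, hvb, e⟩ := exists_adj_of_connected hC hyC hy hxC h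
  exact hvb (mem_componentIn_of_adj hu (hCY hv) e)

lemma exists_adj_componentIn (hC : (G.induce C).Connected) (hb : b ∈ C) (hbY : b ∈ Y) (hz : x ∈ C)
    (hzY : x ∉ Y) : ∃ u ∈ G.componentIn Y b, ∃ v ∈ C, v ∉ Y ∧ G.Adj u v := by
  obtain ⟨u, -, v, hv, hu, hvK, e⟩ := exists_adj_of_connected hC hb (mem_componentIn_self hbY) hz
    (fun h => hzY (componentIn_subset h))
  exact ⟨u, hu, v, hv, fun h => hvK (mem_componentIn_of_adj hu h e), e⟩

/-- Removing a vertex `s` from a connected set leaves components that touch `s`. -/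
lemma componentIn_diff_touches (hW : (G.induce W).Connected) (hb : b ∈ W) (hs : s ∈ W)
    (h : b ≠ s) : G.Touches (G.componentIn (W \ {s}) b) {s} := by
  obtain ⟨u, hu, v, hv, hvY, e⟩ := exists_adj_componentIn (Y := W \ {s}) hW hb ⟨hb, h⟩ hs
    (fun h => h.2 rfl)
  have : v = s := by
    by_contra hne
    exact hvY ⟨hv, hne⟩
  exact ⟨u, hu, v, this, e⟩

/-- `S` and `T` are connected sets meeting only in `a`, and `W` is a connected set containing `b`,
disjoint from both of them and touching both of them. -/
structure Fan (G : SimpleGraph V) (a b : V) (S T W : Set V) : Prop where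
  left_mem : a ∈ S
  right_mem : a ∈ T
  inter : ∀ x ∈ S, x ∈ T → x = a
  left_connected : (G.induce S).Connected
  right_connected : (G.induce T).Connected
  connected : (G.induce W).Connected
  mem : b ∈ W
  left_disjoint : ∀ x ∈ S, x ∉ W
  right_disjoint : ∀ x ∈ T, x ∉ W
  left_touches : G.Touches S W
  right_touches : G.Touches T W

lemma Fan.symm (h : G.Fan a b S T W) : G.Fan a b T S W :=
  ⟨h.2, h.1, fun x hx hy => h.3 x hy hx, h.5, h.4, h.6, h.7, h.9, h.8, h.11, h.10⟩

/-- Moving a vertex of `W` to `S`. -/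
lemma Fan.shrink (h : G.Fan a b S T W) (hs : s ∈ W) (hsb : s ≠ b) (hS : G.Touches S {s})
    (hT : G.Touches T (G.componentIn (W \ {s}) b)) :
    G.Fan a b (insert s S) T (G.componentIn (W \ {s}) b) := by
  have hb : b ∈ W \ {s} := ⟨h.mem, hsb.symm⟩
  have hsub : G.componentIn (W \ {s}) b ⊆ W \ {s} := componentIn_subset
  refine ⟨.inr h.1, h.2, ?_, insert_connected h.4 hS, h.5, componentIn_connected hb,
    mem_componentIn_self hb, ?_, fun x hx hxW => h.9 x hx (hsub hxW).1, ?_, hT⟩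
  · rintro x (rfl | hx) hxT
    · exact absurd hs (h.9 _ hxT)
    · exact h.3 x hx hxT
  · rintro x (rfl | hx) hxW
    · exact (hsub hxW).2 rfl
    · exact h.8 x hx (hsub hxW).1
  · exact (componentIn_diff_touches h.6 h.7 hs hsb.symm).symm.mono (by simp) subset_rfl

/-- Rerouting around a vertex `c` that alone connects `W` to `S` and `T`. -/
lemma Fan.reroute (h : G.Fan a b S T W) (hc : c ∈ W) (hcb : c ≠ b)
    (hS : ∀ x ∈ S, ∀ w ∈ W, G.Adj x w → w = c) (hx : x ∈ G.componentIn (S ∪ T ∪ {c})ᶜ b)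
    (hy : y ∈ S) (e : G.Adj x y)
    (hTc : G.Touches T {c}) :
    ∃ S' T', G.Fan a b S' T' (G.componentIn (W \ {c}) b) := by
  set K := G.componentIn (S ∪ T ∪ {c})ᶜ b with hK
  set W' := G.componentIn (W \ {c}) b with hW'
  have hb : b ∈ W \ {c} := ⟨h.mem, hcb.symm⟩
  have hsub : W' ⊆ W \ {c} := componentIn_subset
  have hbK : b ∈ (S ∪ T ∪ {c})ᶜ := by
    rintro ((h1 | h1) | h1)
    · exact h.8 b h1 h.mem
    · exact h.9 b h1 h.mem
    · exact hcb h1.symm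
  have hKsub : K ⊆ (S ∪ T ∪ {c})ᶜ := componentIn_subset
  have hKS : ∀ z ∈ K, z ∉ S := fun z hz h1 => hKsub hz (.inl (.inl h1))
  have hKT : ∀ z ∈ K, z ∉ T := fun z hz h1 => hKsub hz (.inl (.inr h1))
  have hKc : c ∉ K := fun hz => hKsub hz (.inr rfl)
  have hW'K : W' ⊆ K := by
    refine subset_componentIn (componentIn_connected hb) ?_ (mem_componentIn_self hb)
    rintro z hz ((h1 | h1) | h1)
    · exact h.8 z h1 (hsub hz).1
    · exact h.9 z h1 (hsub hz).1
    · exact (hsub hz).2 h1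
  have hxW : x ∉ W := fun hxW => hKc (hS y hy x hxW e.symm ▸ hx)
  have hxW' : x ∈ K \ W' := ⟨hx, fun h1 => hxW (hsub h1).1⟩
  set L := G.componentIn (K \ W') x with hL
  have hLsub : L ⊆ K \ W' := componentIn_subset
  have hLW : G.Touches L W' := by
    obtain ⟨u, hu, v, hv, hvY, e⟩ := exists_adj_componentIn (Y := K \ W')
      (componentIn_connected hbK) hx hxW' (mem_componentIn_self hbK)
      (fun h1 => h1.2 (mem_componentIn_self hb))
    exact ⟨u, hu, v, by_contra fun h1 => hvY ⟨hv, h1⟩, e⟩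
  refine ⟨S ∪ L, insert c T, .inl h.1, .inr h.2, ?_, ?_, insert_connected h.5 hTc,
    componentIn_connected hb, mem_componentIn_self hb, ?_, ?_, ?_, ?_⟩
  · rintro z (hz | hz) (rfl | hz')
    · exact absurd hc (h.8 _ hz)
    · exact h.3 z hz hz'
    · exact absurd (hLsub hz).1 hKc
    · exact absurd hz' (hKT z (hLsub hz).1)
  · exact Touches.union_connected ⟨y, hy, x, mem_componentIn_self hxW', e.symm⟩ h.4
      (componentIn_connected hxW')
  · rintro z (hz | hz) hzW
    · exact h.8 z hz (hsub hzW).1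
    · exact (hLsub hz).2 hzW
  · rintro z (rfl | hz) hzW
    · exact (hsub hzW).2 rfl
    · exact h.9 z hz (hsub hzW).1
  · exact hLW.mono Set.subset_union_right subset_rfl
  · exact (componentIn_diff_touches h.6 h.7 hc hcb.symm).symm.mono (by simp) subset_rfl

/-- If no vertex other than `a` and `b` separates two nonadjacent vertices `a` and `b`, then there
are two disjoint connected sets avoiding `a` and `b` that touch both of them. -/
lemma Fan.exists_disjoint [Finite V] (hab : ¬ G.Adj a b)
    (hsep : ∀ c, c ≠ a → c ≠ b → ∃ C : Set V, (G.induce C).Connected ∧ a ∈ C ∧ b ∈ C ∧ c ∉ C)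
    (h : G.Fan a b S T W) :
    ∃ S' T' : Set V, S' ⊆ {a, b}ᶜ ∧ T' ⊆ {a, b}ᶜ ∧
      (G.induce S').Connected ∧ (G.induce T').Connected ∧ Disjoint S' T' ∧
      G.Touches S' {a} ∧ G.Touches S' {b} ∧ G.Touches T' {a} ∧ G.Touches T' {b} := by
  induction hn : W.ncard using Nat.strong_induction_on generalizing S T W with
  | _ n ih =>
  subst hn
  have hlt : ∀ s ∈ W, (G.componentIn (W \ {s}) b).ncard < W.ncard := fun s hs =>
    Set.ncard_lt_ncard (componentIn_subset.trans_ssubset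
      (Set.sdiff_singleton_ssubset.2 hs)) (Set.toFinite _)
  by_cases hfin : G.Touches S {b} ∧ G.Touches T {b}
  · have key : ∀ R : Set V, a ∈ R → (G.induce R).Connected → G.Touches R {b} →
        ∃ R' ⊆ R \ {a}, (G.induce R').Connected ∧ G.Touches R' {a} ∧ G.Touches R' {b} := by
      rintro R haR hR ⟨u, hu, _, rfl, e⟩
      have hua : u ≠ a := fun h => hab (h ▸ e)
      have hu' : u ∈ R \ {a} := ⟨hu, hua⟩
      exact ⟨G.componentIn (R \ {a}) u, componentIn_subset, componentIn_connected hu',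
        componentIn_diff_touches hR hu haR hua, ⟨u, mem_componentIn_self hu', _, rfl, e⟩⟩
    obtain ⟨S', hS', hSc, hSa, hSb⟩ := key S h.1 h.4 hfin.1
    obtain ⟨T', hT', hTc, hTa, hTb⟩ := key T h.2 h.5 hfin.2
    have hsub : ∀ R ⊆ Wᶜ, R \ {a} ⊆ {a, b}ᶜ := by
      rintro R hR z ⟨hz, hza⟩ (rfl | rfl)
      · exact hza rfl
      · exact hR hz h.mem
    exact ⟨S', T', hS'.trans (hsub S h.8), hT'.trans (hsub T h.9), hSc, hTc,
      Set.disjoint_left.2 fun x hx hx' =>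
      (hS' hx).2 (h.3 x (hS' hx).1 (hT' hx').1), hSa, hSb, hTa, hTb⟩
  by_cases h1 : ∃ s ∈ W, s ≠ b ∧ G.Touches S {s} ∧ G.Touches T (G.componentIn (W \ {s}) b)
  · obtain ⟨s, hs, hsb, hS, hT⟩ := h1
    exact ih _ (hlt s hs) (h.shrink hs hsb hS hT) rfl
  by_cases h2 : ∃ s ∈ W, s ≠ b ∧ G.Touches T {s} ∧ G.Touches S (G.componentIn (W \ {s}) b)
  · obtain ⟨s, hs, hsb, hT, hS⟩ := h2
    exact ih _ (hlt s hs) (h.symm.shrink hs hsb hT hS).symm rfl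
  have hself : ∀ s, s ≠ b → b ∈ G.componentIn (W \ {s}) b := fun s hs =>
    mem_componentIn_self ⟨h.mem, hs.symm⟩
  obtain ⟨x, hx, s, hs, es⟩ := h.left_touches
  obtain ⟨y, hy, t, ht, et⟩ := h.right_touches
  have hSb : ¬ G.Touches S {b} := fun hSb => by
    have htb : t ≠ b := fun h' => hfin ⟨hSb, y, hy, t, h', et⟩
    exact h2 ⟨t, ht, htb, ⟨y, hy, t, rfl, et⟩, hSb.mono subset_rfl (by simpa using hself t htb)⟩
  have hTb : ¬ G.Touches T {b} := fun hTb => by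
    have hsb : s ≠ b := fun h' => hSb ⟨x, hx, s, h', es⟩
    exact h1 ⟨s, hs, hsb, ⟨x, hx, s, rfl, es⟩, hTb.mono subset_rfl (by simpa using hself s hsb)⟩
  have heq : ∀ s ∈ W, ∀ t ∈ W, G.Touches S {s} → G.Touches T {t} → s = t := by
    intro s hs t ht hS hT
    by_contra hst
    have hsb : s ≠ b := fun h' => hSb (h' ▸ hS)
    have htb : t ≠ b := fun h' => hTb (h' ▸ hT)
    have htK : t ∉ G.componentIn (W \ {s}) b := fun htK =>
      h1 ⟨s, hs, hsb, hS, hT.mono subset_rfl (by simpa using htK)⟩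
    have hconn := insert_connected 
      (componentIn_connected (G := G) (show b ∈ W \ {s} from ⟨h.mem, hsb.symm⟩))
      (componentIn_diff_touches h.6 h.7 hs hsb.symm)
    refine h2 ⟨t, ht, htb, hT, hS.mono subset_rfl ?_⟩
    rw [Set.singleton_subset_iff]
    refine subset_componentIn hconn ?_ (.inr (hself s hsb)) (.inl rfl)
    rintro z (rfl | hz)
    · exact ⟨hs, hst⟩
    · exact ⟨(componentIn_subset hz).1, fun h' => htK (h' ▸ hz)⟩
  have hst : s = t := heq s hs t ht ⟨x, hx, s, rfl, es⟩ ⟨y, hy, t, rfl, et⟩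
  subst hst
  have hsb : s ≠ b := fun h' => hSb ⟨x, hx, s, h', es⟩
  obtain ⟨C, hC, haC, hbC, hsC⟩ := hsep s (fun h' => h.8 a h.1 (h' ▸ hs)) hsb
  have hb : b ∈ (S ∪ T ∪ {s})ᶜ := by
    rintro ((h' | h') | h')
    · exact h.8 b h' h.mem
    · exact h.9 b h' h.mem
    · exact hsb h'.symm
  obtain ⟨u, hu, v, hv, hvY, e⟩ := exists_adj_componentIn (Y := (S ∪ T ∪ {s})ᶜ) hC hbC hb haC
    (fun h' => h' (.inl (.inl h.1)))
  obtain (hvS | hvT) | hvs := not_not.1 hvY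
  · obtain ⟨S', T', h'⟩ := h.reroute hs hsb (fun p hp w hw e =>
      heq w hw s hs ⟨p, hp, w, rfl, e⟩ ⟨y, hy, s, rfl, et⟩) hu hvS e ⟨y, hy, s, rfl, et⟩
    exact ih _ (hlt s hs) h' rfl
  · obtain ⟨S', T', h'⟩ := h.symm.reroute hs hsb (fun p hp w hw e =>
      (heq s hs w hw ⟨x, hx, s, rfl, es⟩ ⟨p, hp, w, rfl, e⟩).symm)
      (by rwa [Set.union_comm T S]) hvT e ⟨x, hx, s, rfl, es⟩
    exact ih _ (hlt s hs) h' rfl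
  · exact absurd (hvs ▸ hv) hsC

/-- If `U` is a connected set touching the vertices `a` and `b` outside `U`, then either some vertex
`c` of `U` separates `a` from `b` within `U`, or `U` contains two disjoint connected sets that
touch both `a` and `b`. -/
lemma exists_separator_or_disjoint [Finite V] {U : Set V} (hU : (G.induce U).Connected)
    (ha : a ∉ U) (hb : b ∉ U) (hab : a ≠ b) (hUa : G.Touches U {a}) (hUb : G.Touches U {b}) :
    (∃ c ∈ U, ∀ C ⊆ U \ {c}, (G.induce C).Connected → ¬ (G.Touches C {a} ∧ G.Touches C {b})) ∨
    ∃ S ⊆ U, ∃ T ⊆ U, (G.induce S).Connected ∧ (G.induce T).Connected ∧ Disjoint S T ∧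
      G.Touches S {a} ∧ G.Touches S {b} ∧ G.Touches T {a} ∧ G.Touches T {b} := by
  by_contra! hcon
  obtain ⟨h1, h2⟩ := hcon
  let H : SimpleGraph V :=
    { Adj := fun x y => G.Adj x y ∧ ((x ∈ U ∧ y ∈ U ∪ {a, b}) ∨ (y ∈ U ∧ x ∈ U ∪ {a, b}))
      symm := ⟨fun x y h => ⟨h.1.symm, h.2.symm⟩⟩
      loopless := ⟨fun x h => G.loopless.irrefl x h.1⟩ }
  have hHG : H ≤ G := fun x y h => h.1
  have hind : ∀ C ⊆ U, (G.induce C).Connected → (H.induce C).Connected := fun C hCU hC =>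
    hC.mono fun x y h => ⟨h, .inl ⟨hCU x.2, .inl (hCU y.2)⟩⟩
  have htou : ∀ C ⊆ U, ∀ x ∈ ({a, b} : Set V), G.Touches C {x} → H.Touches C {x} := by
    rintro C hCU x hx ⟨u, hu, _, rfl, e⟩
    exact ⟨u, hu, _, rfl, e, .inl ⟨hCU hu, .inr hx⟩⟩
  have hHt : ∀ C ⊆ U, (G.induce C).Connected → G.Touches C {a} → G.Touches C {b} →
      (H.induce (insert a (insert b C))).Connected := fun C hCU hC hCa hCb =>
    insert_connected (insert_connected (hind C hCU hC) (htou C hCU b (by simp) hCb))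
      ((htou C hCU a (by simp) hCa).mono (Set.subset_insert _ _) subset_rfl)
  have hFan : H.Fan a b {a} {a} (insert b U) :=
    ⟨rfl, rfl, fun x hx _ => hx, induce_singleton_connected a, induce_singleton_connected a,
      insert_connected (hind U subset_rfl hU) (htou U subset_rfl b (by simp) hUb), .inl rfl,
      by simp [hab, ha], by simp [hab, ha],
      (htou U subset_rfl a (by simp) hUa).symm.mono subset_rfl (Set.subset_insert _ _),
      (htou U subset_rfl a (by simp) hUa).symm.mono subset_rfl (Set.subset_insert _ _)⟩
  obtain ⟨S, T, hSab, hTab, hS, hT, hST, hSa, hSb, hTa, hTb⟩ := hFan.exists_disjoint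
    (by rintro ⟨-, h | h⟩ <;> tauto) (fun c hca hcb => by
      by_cases hc : c ∈ U
      · obtain ⟨C, hCU, hC, hCa, hCb⟩ := h1 c hc
        have hCU' : C ⊆ U := hCU.trans Set.sdiff_subset
        refine ⟨_, hHt C hCU' hC hCa hCb, by simp, by simp, ?_⟩
        rintro (h | h | h)
        · exact hca h
        · exact hcb h
        · exact (hCU h).2 rfl
      · exact ⟨_, hHt U subset_rfl hU hUa hUb, by simp, by simp, by simp [hca, hcb, hc]⟩)
  have hsub : ∀ R ⊆ ({a, b} : Set V)ᶜ, (H.induce R).Connected → H.Touches R {a} → R ⊆ U := by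
    rintro R hRab hR ⟨u, hu, _, rfl, e⟩ z hz
    have huU : u ∈ U := by
      obtain h | h := e.2
      · exact h.1
      · exact absurd h.1 ha
    by_contra hzU
    obtain ⟨p, -, q, hq, hpU, hqU, e'⟩ := exists_adj_of_connected hR hu huU hz hzU
    obtain h | h := e'.2
    · exact h.2.elim hqU (hRab hq)
    · exact hqU h.1
  have hsub' : ∀ R : Set V, (H.induce R).Connected → (G.induce R).Connected := fun R hR =>
    hR.mono fun x y h => hHG h
  have htou' : ∀ (R : Set V) x, H.Touches R {x} → G.Touches R {x} := by
    rintro R x ⟨u, hu, v, hv, e⟩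
    exact ⟨u, hu, v, hv, hHG e⟩
  exact h2 S (hsub S hSab hS hSa) T (hsub T hTab hT hTa) (hsub' S hS) (hsub' T hT) hST
    (htou' _ _ hSa) (htou' _ _ hSb) (htou' _ _ hTa) (htou' _ _ hTb)

/-- A sequence of pairwise disjoint connected sets indexed by the integers between `p` and `q`,
consecutive ones touching each other. -/
structure BlockPath (G : SimpleGraph V) (f : ℤ → Set V) (p q : ℤ) : Prop where
  connected : ∀ i, p ≤ i → i ≤ q → (G.induce (f i)).Connected
  disjoint : ∀ i j, p ≤ i → i < j → j ≤ q → Disjoint (f i) (f j)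
  touches : ∀ i, p ≤ i → i < q → G.Touches (f i) (f (i + 1))

namespace BlockPath

variable {f : ℤ → Set V} {p q : ℤ}

lemma mono (h : G.BlockPath f p q) {p' q' : ℤ} (hp : p ≤ p') (hq : q' ≤ q) :
    G.BlockPath f p' q' :=
  ⟨fun i h1 h2 => h.1 i (hp.trans h1) (h2.trans hq),
    fun i j h1 h2 h3 => h.2 i j (hp.trans h1) h2 (h3.trans hq),
    fun i h1 h2 => h.3 i (hp.trans h1) (h2.trans_le hq)⟩

lemma reverse (h : G.BlockPath f p q) : G.BlockPath (fun i => f (-i)) (-q) (-p) := by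
  refine ⟨fun i h1 h2 => h.1 _ (by lia) (by lia),
    fun i j h1 h2 h3 => (h.2 (-j) (-i) (by lia) (by lia) (by lia)).symm, fun i h1 h2 => ?_⟩
  have := h.3 (-(i + 1)) (by lia) (by lia)
  rw [neg_add_rev, neg_add_cancel_comm] at this
  exact (neg_add_rev i 1 ▸ this).symm

lemma cons (h : G.BlockPath f p q) {E : Set V} (hE : (G.induce E).Connected)
    (hdisj : ∀ i, p ≤ i → i ≤ q → Disjoint E (f i)) (ht : p ≤ q → G.Touches E (f p)) :
    G.BlockPath (Function.update f (p - 1) E) (p - 1) q := by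
  have hne : ∀ i, p ≤ i → Function.update f (p - 1) E i = f i := fun i hi =>
    Function.update_of_ne (by lia) _ _
  refine ⟨fun i h1 h2 => ?_, fun i j h1 h2 h3 => ?_, fun i h1 h2 => ?_⟩ <;>
    obtain rfl | h1 := h1.eq_or_lt
  · rw [Function.update_self]
    exact hE
  · rw [hne i (by lia)]
    exact h.1 i (by lia) h2
  · rw [hne j (by lia), Function.update_self]
    exact hdisj j (by lia) h3
  · rw [hne i (by lia), hne j (by lia)]
    exact h.2 i j (by lia) h2 h3
  · rw [hne (p - 1 + 1) (by lia), Function.update_self, sub_add_cancel]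
    exact ht (by lia)
  · rw [hne i (by lia), hne (i + 1) (by lia)]
    exact h.3 i (by lia) h2

lemma iUnion_connected (h : G.BlockPath f p q) {m n : ℤ} (hm : p ≤ m) (hmn : m ≤ n) (hn : n ≤ q) :
    (G.induce (⋃ i ∈ Set.Icc m n, f i)).Connected := by
  induction n, hmn using Int.leInduction with
  | base =>
    rw [Set.Icc_self, Set.biUnion_singleton]
    exact h.connected m hm hn
  | succ n hmn ih =>
    have hI : Set.Icc m (n + 1) = Set.Icc m n ∪ {n + 1} := by
      ext i
      simp only [Set.mem_Icc, Set.mem_union, Set.mem_singleton_iff]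
      lia
    rw [hI, Set.biUnion_union, Set.biUnion_singleton]
    refine Touches.union_connected ?_ (ih (by lia)) (h.connected _ (by lia) hn)
    exact (h.touches n (by lia) (by lia)).mono
      (Set.subset_biUnion_of_mem (u := f) (Set.mem_Icc.2 ⟨hmn, le_rfl⟩)) subset_rfl

/-- An integer interval containing at least `k` elements of `I` splits into `k` consecutive
intervals meeting `I`. -/
lemma _root_.exists_boundaries {p q : ℤ} {I : Finset ℤ} (hI : ∀ i ∈ I, p ≤ i ∧ i ≤ q) {k : ℕ}
    (hk : 0 < k) (hkI : k ≤ I.card) : ∃ c : ℕ → ℤ, c 0 = p ∧ c k = q + 1 ∧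
      ∀ i < k, ∃ e ∈ I, c i ≤ e ∧ e < c (i + 1) := by
  obtain ⟨I', hI'I, hcard⟩ := Finset.exists_subset_card_eq hkI
  set e := I'.orderEmbOfFin hcard
  have heI : ∀ i, e i ∈ I := fun i => hI'I (I'.orderEmbOfFin_mem hcard i)
  let c : ℕ → ℤ := fun i => if i = 0 then p else if h : i < k then e ⟨i, h⟩ else q + 1
  have hc0 : c 0 = p := if_pos rfl
  have hck : c k = q + 1 := by simp [c, hk.ne']
  have hci : ∀ i (hi : i < k), i ≠ 0 → c i = e ⟨i, hi⟩ := fun i hi h0 => by simp [c, hi, h0]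
  refine ⟨c, hc0, hck, fun i hi => ⟨e ⟨i, hi⟩, heI _, ?_, ?_⟩⟩
  · by_cases h0 : i = 0
    · subst h0
      exact hc0 ▸ (hI _ (heI _)).1
    · exact (hci i hi h0).le
  · by_cases h1 : i + 1 < k
    · rw [hci _ h1 (by lia)]
      exact e.strictMono (by simp)
    · rw [show i + 1 = k by lia, hck]
      exact Int.lt_add_one_of_le (hI _ (heI _)).2

/-- A cyclic sequence of blocks, at least `k` of which are touched by a disjoint connected set,
yields a wheel minor. -/
lemma isMinor_wheel (h : G.BlockPath f p q) (hclosed : G.Touches (f q) (f p)) {H : Set V}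
    (hH : (G.induce H).Connected) (hdisj : ∀ i, p ≤ i → i ≤ q → Disjoint H (f i)) {I : Finset ℤ}
    (hI : ∀ i ∈ I, p ≤ i ∧ i ≤ q) (hHI : ∀ i ∈ I, G.Touches H (f i)) {k : ℕ} (hk : 0 < k)
    (hkI : k ≤ I.card) : IsMinor (wheel k) G := by
  obtain ⟨c, hc0, hck, hc⟩ := exists_boundaries hI hk hkI
  have hlt : ∀ i < k, c i < c (i + 1) := fun i hi =>
    let ⟨_, _, h1, h2⟩ := hc i hi
    h1.trans_lt h2
  have hcc : ∀ i j, i ≤ j → j ≤ k → c i ≤ c j := fun i j hij => by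
    induction j, hij using Nat.le_induction with
    | base => exact fun _ => le_rfl
    | succ j _ ih => exact fun hj => (ih (by lia)).trans (hlt j hj).le
  have hpc : ∀ i ≤ k, p ≤ c i := fun i hi => hc0 ▸ hcc 0 i (Nat.zero_le i) hi
  have hcq : ∀ i ≤ k, c i ≤ q + 1 := fun i hi => hck ▸ hcc i k hi le_rfl
  let J : Fin k → Set ℤ := fun i => Set.Icc (c i) (c (i + 1) - 1)
  have hJ : ∀ i, ∀ j ∈ J i, p ≤ j ∧ j ≤ q := fun i j hj => by
    have h1 := hpc i i.2.le
    have h2 := hcq (i + 1) i.2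
    have h3 : c i ≤ j ∧ j ≤ c (i + 1) - 1 := hj
    lia
  let M : Option (Fin k) → Set V := fun o => o.elim H fun i => ⋃ j ∈ J i, f j
  have hfM : ∀ i, ∀ j ∈ J i, f j ⊆ M (some i) := fun i j hj =>
    Set.subset_biUnion_of_mem (u := f) hj
  have hHM : ∀ i, Disjoint H (M (some i)) := fun i =>
    Set.disjoint_iUnion₂_right.2 fun j hj => hdisj j (hJ i j hj).1 (hJ i j hj).2
  have hMM : ∀ i j, i < j → Disjoint (M (some i)) (M (some j)) := fun i j hij =>
    Set.disjoint_iUnion₂_left.2 fun m hm => Set.disjoint_iUnion₂_right.2 fun n hn => by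
      have h1 := hcc (i + 1) j hij j.2.le
      have h2 : m ≤ c (i + 1) - 1 := hm.2
      have h3 : c j ≤ n := hn.1
      exact h.disjoint m n (hJ i m hm).1 (by lia) (hJ j n hn).2
  have hspoke : ∀ i, G.Touches (M none) (M (some i)) := fun i =>
    let ⟨e, he, h1, h2⟩ := hc i i.2
    (hHI e he).mono subset_rfl (hfM i _ ⟨h1, Int.le_sub_one_of_lt h2⟩)
  have hrim : ∀ i j : Fin k, (j : ℕ) = ((i : ℕ) + 1) % k → G.Touches (M (some i)) (M (some j)) := by
    intro i j hij
    have h1 : c i ≤ c (i + 1) - 1 := Int.le_sub_one_of_lt (hlt i i.2)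
    have h2 : c j ≤ c (j + 1) - 1 := Int.le_sub_one_of_lt (hlt j j.2)
    by_cases h3 : (i : ℕ) + 1 < k
    · rw [Nat.mod_eq_of_lt h3] at hij
      have h4 : c j = c (i + 1) := congrArg c hij
      have h5 := hpc i i.2.le
      have h6 := hcq (j + 1) j.2
      refine Touches.mono (h.touches (c (i + 1) - 1) (by lia) (by lia))
        (hfM i _ ⟨h1, le_rfl⟩) (hfM j _ ?_)
      rw [sub_add_cancel, ← h4]
      exact ⟨le_rfl, h2⟩
    · have hik : (i : ℕ) + 1 = k := by lia
      rw [hik, Nat.mod_self] at hij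
      have h4 : c (i + 1) - 1 = q := by rw [hik, hck, add_sub_cancel_right]
      have h5 : c j = p := hij ▸ hc0
      exact hclosed.mono (hfM i _ (h4 ▸ ⟨h1, le_rfl⟩)) (hfM j _ (h5 ▸ ⟨le_rfl, h2⟩))
  refine ⟨M, ?_, ?_, ?_⟩
  · rintro (_ | i)
    · exact hH
    · have h1 := hlt i i.2
      have h2 := hcq (i + 1) i.2
      exact h.iUnion_connected (hpc i i.2.le) (by lia) (by lia)
  · rintro (_ | i) (_ | j) hne
    · exact absurd rfl hne
    · exact hHM j
    · exact (hHM i).symm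
    · obtain hij | hij := lt_or_gt_of_ne (fun h' : i = j => hne (h' ▸ rfl))
      · exact hMM i j hij
      · exact (hMM j i hij).symm
  · rintro (_ | i) (_ | j) hadj
    · exact absurd rfl hadj.ne
    · exact hspoke j
    · exact (hspoke i).symm
    · obtain ⟨-, hij | hij⟩ := (SimpleGraph.fromRel_adj _ _ _).1 hadj
      · exact hrim i j hij
      · exact (hrim j i hij).symm

end BlockPath

lemma IsTree.sum_sup_edge {ι κ : Type*} [Finite ι] [Finite κ] {g : SimpleGraph ι}
    {h : SimpleGraph κ} (hg : g.IsTree) (hh : h.IsTree) (i : ι) (j : κ) :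
    ((g ⊕g h) ⊔ edge (.inl i) (.inr j)).IsTree := by
  rw [isTree_iff_connected_and_card] at hg hh ⊢
  refine ⟨hg.1.sum_sup_edge hh.1, ?_⟩
  have hij : s(.inl i, .inr j) ∉ (g ⊕g h).edgeSet :=
    not_adj_sum_inl_inr (G := g) (H := h) i j
  rw [edgeSet_sup, edgeSet_edge_of_ne Sum.inl_ne_inr, Nat.card_coe_set_eq, Set.union_singleton,
    Set.ncard_insert_of_notMem hij, ← Nat.card_coe_set_eq,
    Nat.card_congr edgeSetSumEquiv, Nat.card_sum, Nat.card_sum]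
  lia

lemma Connected.induce_image {ι κ : Type*} {g : SimpleGraph ι} {h : SimpleGraph κ} (φ : g →g h)
    {s : Set ι} (hs : (g.induce s).Connected) : (h.induce (φ '' s)).Connected :=
  Connected.map (induceHom φ (Set.mapsTo_image φ s)) (by
    rintro ⟨_, x, hx, rfl⟩
    exact ⟨⟨x, hx⟩, rfl⟩) hs

/-- There is a tree decomposition of the subgraph of `G` induced by `Y`, with bags of size at most
`w`, one of which contains `B`. -/
def HasTreeDecomposition (G : SimpleGraph V) (w : ℕ) (Y B : Set V) : Prop :=
  ∃ (ι : Type) (_ : Finite ι) (t : SimpleGraph ι) (bag : ι → Set V),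
    t.IsTree ∧ (∀ i, bag i ⊆ Y) ∧
    (∀ u ∈ Y, ∀ v ∈ Y, G.Adj u v → ∃ i, u ∈ bag i ∧ v ∈ bag i) ∧
    (∀ v ∈ Y, (t.induce {i | v ∈ bag i}).Connected) ∧
    (∀ i, (bag i).ncard ≤ w) ∧ ∃ i, B ⊆ bag i

namespace HasTreeDecomposition

variable {w : ℕ}

lemma of_ncard_le (h : B.ncard ≤ w) : G.HasTreeDecomposition w B B :=
  ⟨Unit, inferInstance, ⊥, fun _ => B, .of_subsingleton, fun _ => subset_rfl,
    fun _ hu _ hv _ => ⟨(), hu, hv⟩, fun v hv =>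
      haveI : Nonempty {_i : Unit | v ∈ B} := ⟨⟨(), hv⟩⟩
      ⟨.of_subsingleton⟩, fun _ => h, (), subset_rfl⟩

lemma glue (h₁ : G.HasTreeDecomposition w S A) (h₂ : G.HasTreeDecomposition w T B) (hBA : B ⊆ A)
    (hST : S ∩ T ⊆ B) (h : ∀ x ∈ S, ∀ y ∈ T, G.Adj x y → x ∈ T ∨ y ∈ S) :
    G.HasTreeDecomposition w (S ∪ T) A := by
  obtain ⟨ι, _, g, bag, hg, hbS, hadj, hconn, hcard, i, hi⟩ := h₁
  obtain ⟨κ, _, g', bag', hg', hbT, hadj', hconn', hcard', j, hj⟩ := h₂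
  have hcross : ∀ x ∈ S, ∀ y ∈ T, G.Adj x y → ∃ l, x ∈ Sum.elim bag bag' l ∧
      y ∈ Sum.elim bag bag' l := fun x hx y hy e => by
    obtain hx' | hy' := h x hx y hy e
    · obtain ⟨l, hl⟩ := hadj' x hx' y hy e
      exact ⟨.inr l, hl⟩
    · obtain ⟨l, hl⟩ := hadj x hx y hy' e
      exact ⟨.inl l, hl⟩
  set t := (g ⊕g g') ⊔ edge (.inl i) (.inr j)
  let φ : g →g t := (Hom.ofLE le_sup_left).comp Embedding.sumInl.toHom
  let ψ : g' →g t := (Hom.ofLE le_sup_left).comp Embedding.sumInr.toHom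
  have hpre : ∀ v, {l | v ∈ Sum.elim bag bag' l} =
      φ '' {l | v ∈ bag l} ∪ ψ '' {l | v ∈ bag' l} := by
    intro v
    ext (l | l)
    · simp [φ, ψ]
    · simp [φ, ψ]
  refine ⟨ι ⊕ κ, inferInstance, t, Sum.elim bag bag', hg.sum_sup_edge hg' i j, ?_, ?_, ?_, ?_,
    .inl i, hi⟩
  · rintro (l | l)
    · exact (hbS l).trans Set.subset_union_left
    · exact (hbT l).trans Set.subset_union_right
  · rintro x (hx | hx) y (hy | hy) e
    · obtain ⟨l, hl⟩ := hadj x hx y hy e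
      exact ⟨.inl l, hl⟩
    · exact hcross x hx y hy e
    · obtain ⟨l, hl⟩ := hcross y hy x hx e.symm
      exact ⟨l, hl.symm⟩
    · obtain ⟨l, hl⟩ := hadj' x hx y hy e
      exact ⟨.inr l, hl⟩
  · intro v hv
    rw [hpre]
    by_cases hS : v ∈ S <;> by_cases hT : v ∈ T
    · refine Touches.union_connected ⟨_, ⟨i, hi (hBA (hST ⟨hS, hT⟩)), rfl⟩, _,
        ⟨j, hj (hST ⟨hS, hT⟩), rfl⟩, ?_⟩
        ((hconn v hS).induce_image φ) ((hconn' v hT).induce_image ψ)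
      exact .inr (edge_adj .. |>.2 ⟨.inl ⟨rfl, rfl⟩, Sum.inl_ne_inr⟩)
    · have : {l | v ∈ bag' l} = ∅ := Set.eq_empty_of_forall_notMem fun l hl => hT (hbT l hl)
      rw [this, Set.image_empty, Set.union_empty]
      exact (hconn v hS).induce_image φ
    · have : {l | v ∈ bag l} = ∅ := Set.eq_empty_of_forall_notMem fun l hl => hS (hbS l hl)
      rw [this, Set.image_empty, Set.empty_union]
      exact (hconn' v hT).induce_image ψ
    · exact absurd hv (by simp [hS, hT])
  · rintro (l | l)
    · exact hcard l
    · exact hcard' l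

lemma treewidth_le [Fintype V] (h : G.HasTreeDecomposition (w + 1) Set.univ B) :
    treewidth G ≤ w := by
  classical
  obtain ⟨ι, _, t, bag, ht, -, hadj, hconn, hcard, -⟩ := h
  refine Nat.sInf_le ⟨ι, Fintype.ofFinite ι, t, fun i => (bag i).toFinset, ht, fun v => ?_,
    fun u v e => ?_, fun v => ?_, fun i => ?_⟩
  · obtain ⟨i, hi⟩ := (hconn v (Set.mem_univ v)).nonempty
    exact ⟨i, Set.mem_toFinset.2 hi⟩
  · simpa using hadj u (Set.mem_univ u) v (Set.mem_univ v) e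
  · have := hconn v (Set.mem_univ v)
    rwa [show {i | v ∈ (bag i).toFinset} = {i | v ∈ bag i} by ext; simp]
  · rw [← Set.ncard_eq_toFinset_card']
    exact hcard i

end HasTreeDecomposition

/-- The vertices outside `U` with a neighbour in `U`. -/
def boundary (G : SimpleGraph V) (U : Set V) : Set V := {x | x ∉ U ∧ ∃ u ∈ U, G.Adj u x}

lemma boundary_componentIn_subset {b : V} :
    G.boundary (G.componentIn Y b) ⊆ Yᶜ := fun _ ⟨h1, _, hu, e⟩ hY =>
  h1 (mem_componentIn_of_adj hu hY e)

/-- Tree decompositions of the components of `Y` are glued along a bag containing the boundary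
of `Y`. -/
lemma HasTreeDecomposition.of_components [Finite V] {w : ℕ} (hB : B.ncard ≤ w) (hYB : Disjoint Y B)
    (hbd : G.boundary Y ⊆ B)
    (h : ∀ b ∈ Y, G.HasTreeDecomposition w
      (G.componentIn Y b ∪ G.boundary (G.componentIn Y b)) (G.boundary (G.componentIn Y b))) :
    G.HasTreeDecomposition w (B ∪ Y) B := by
  suffices H : ∀ n, ∀ Z ⊆ Y, Z.ncard ≤ n → (∀ x ∈ Z, G.componentIn Y x ⊆ Z) →
      G.HasTreeDecomposition w (B ∪ Z) B from
    H _ Y subset_rfl le_rfl fun x _ => componentIn_subset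
  intro n
  induction n with
  | zero =>
    intro Z _ hZ _
    rw [(Set.ncard_eq_zero).1 (Nat.le_zero.1 hZ), Set.union_empty]
    exact of_ncard_le hB
  | succ n ih =>
    intro Z hZY hZ hcl
    obtain rfl | ⟨b, hb⟩ := Z.eq_empty_or_nonempty
    · rw [Set.union_empty]
      exact of_ncard_le hB
    set K := G.componentIn Y b with hK
    have hKb : G.boundary K ⊆ B := fun x hx => by
      have ⟨_, u, hu, e⟩ := hx
      exact hbd ⟨boundary_componentIn_subset hx, u, componentIn_subset hu, e⟩
    have hKZ : K ⊆ Z := hcl b hb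
    have hbK : b ∈ K := mem_componentIn_self (hZY hb)
    have h1 : G.HasTreeDecomposition w (B ∪ Z \ K) B := by
      refine ih _ (Set.sdiff_subset.trans hZY) ?_ fun x hx y hy => ⟨hcl x hx.1 hy, fun hyK => ?_⟩
      · have := Set.ncard_lt_ncard (s := Z \ K) (t := Z)
          ⟨Set.sdiff_subset, fun h => (h hb).2 hbK⟩
        lia
      · exact Set.disjoint_left.1 (disjoint_componentIn hx.2) hy hyK
    have h2 : B ∪ Z = B ∪ Z \ K ∪ (K ∪ G.boundary K) := by
      ext x
      have h1 := @hKZ x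
      have h2 := @hKb x
      by_cases h3 : x ∈ K
      · simp [h3, h1 h3]
      · simp only [Set.mem_union, Set.mem_sdiff, h3]
        tauto
    rw [h2]
    refine h1.glue (h b (hZY hb)) hKb ?_ ?_
    · rintro x ⟨hx, hx' | hx'⟩
      · obtain hx | hx := hx
        · exact absurd hx (Set.disjoint_left.1 hYB (componentIn_subset hx'))
        · exact absurd hx' hx.2
      · exact hx'
    · rintro x hx y (hy | hy) e
      · by_cases hxK : x ∈ K
        · exact .inl (.inl hxK)
        · exact .inl (.inr ⟨hxK, y, hy, e.symm⟩)
      · exact .inr (.inl (hKb hy))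

lemma HasTreeDecomposition.mono_right {w : ℕ} (h : G.HasTreeDecomposition w Y A) (hBA : B ⊆ A) :
    G.HasTreeDecomposition w Y B := by
  obtain ⟨ι, hι, t, bag, h1, h2, h3, h4, h5, i, hi⟩ := h
  exact ⟨ι, hι, t, bag, h1, h2, h3, h4, h5, i, hBA.trans hi⟩

lemma boundary_componentIn_diff_subset :
    G.boundary (G.componentIn (S \ {c}) b) ⊆ insert c (G.boundary S) := fun x hx => by
  have ⟨_, u, hu, e⟩ := hx
  by_cases hxS : x ∈ S
  · by_contra hxc
    exact boundary_componentIn_subset hx ⟨hxS, fun h => hxc (.inl h)⟩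
  · exact .inr ⟨hxS, u, (componentIn_subset hu).1, e⟩

/-- Two disjoint connected subsets of a connected set extend to a partition of it into two connected
sets. -/
lemma exists_connected_partition (hC : (G.induce C).Connected) (hS : (G.induce S).Connected)
    (hT : (G.induce T).Connected) (hSC : S ⊆ C) (hTC : T ⊆ C) (h : Disjoint S T) :
    ∃ S' T', S ⊆ S' ∧ T ⊆ T' ∧ S' ∪ T' = C ∧ Disjoint S' T' ∧ (G.induce S').Connected ∧
      (G.induce T').Connected := by
  obtain ⟨⟨s, hs⟩⟩ := hS.nonempty
  obtain ⟨⟨t, ht⟩⟩ := hT.nonempty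
  have hST : S ⊆ C \ T := fun x hx => ⟨hSC hx, Set.disjoint_left.1 h hx⟩
  set S' := G.componentIn (C \ T) s with hS'
  have hS'C : S' ⊆ C \ T := componentIn_subset
  have hTT' : T ⊆ C \ S' := fun x hx => ⟨hTC hx, fun hx' => (hS'C hx').2 hx⟩
  refine ⟨S', C \ S', subset_componentIn hS hST hs, hTT',
    Set.union_sdiff_cancel (hS'C.trans Set.sdiff_subset), Set.disjoint_sdiff_right,
    componentIn_connected (hST hs), ?_⟩
  suffices hsub : C \ S' ⊆ G.componentIn (C \ S') t by
    rw [hsub.antisymm componentIn_subset]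
    exact componentIn_connected (hTT' ht)
  intro x hx
  by_cases hxT : x ∈ T
  · exact subset_componentIn hT hTT' ht hxT
  have hx' : x ∈ C \ T := ⟨hx.1, hxT⟩
  have hdis : Disjoint (G.componentIn (C \ T) x) S' := disjoint_componentIn hx.2
  obtain ⟨u, hu, v, hv, hvT, e⟩ := exists_adj_componentIn hC hx.1 hx' (hTC ht) (fun h => h.2 ht)
  have hvT : v ∈ T := by
    by_contra hvT'
    exact hvT ⟨hv, hvT'⟩
  refine subset_componentIn (Touches.union_connected ⟨u, hu, v, hvT, e⟩
    (componentIn_connected hx') hT) (Set.union_subset (fun y hy => ?_) hTT') (.inr ht)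
    (.inl (mem_componentIn_self hx'))
  exact ⟨(componentIn_subset hy).1, Set.disjoint_left.1 hdis hy⟩

/-- A path of blocks avoiding `U` that contains the boundary of `U`, each block containing at most
one vertex of it. -/
structure BoundaryPath (G : SimpleGraph V) (f : ℤ → Set V) (p q : ℤ) (U : Set V) : Prop where
  path : G.BlockPath f p q
  le : p ≤ q + 1
  disjoint : ∀ i, p ≤ i → i ≤ q → Disjoint U (f i)
  cover : ∀ x ∈ G.boundary U, ∃ i, p ≤ i ∧ i ≤ q ∧ x ∈ f i
  unique : ∀ i, p ≤ i → i ≤ q → ∀ x ∈ G.boundary U, ∀ y ∈ G.boundary U, x ∈ f i → y ∈ f i → x = y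

namespace BoundaryPath

variable {f : ℤ → Set V} {p q : ℤ} {U : Set V}

lemma reverse (h : G.BoundaryPath f p q U) : G.BoundaryPath (fun i => f (-i)) (-q) (-p) U := by
  refine ⟨h.path.reverse, by have := h.le; lia,
    fun i h1 h2 => h.disjoint _ (by lia) (by lia), fun x hx => ?_,
    fun i h1 h2 => h.unique _ (by lia) (by lia)⟩
  obtain ⟨i, h1, h2, h3⟩ := h.cover x hx
  exact ⟨-i, by lia, by lia, by simpa using h3⟩

lemma mono (h : G.BoundaryPath f p q U) {p' q' : ℤ} (hp : p ≤ p') (hq : q' ≤ q) (hpq : p' ≤ q' + 1)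
    (hcover : ∀ x ∈ G.boundary U, ∃ i, p' ≤ i ∧ i ≤ q' ∧ x ∈ f i) :
    G.BoundaryPath f p' q' U :=
  ⟨h.path.mono hp hq, hpq, fun i h1 h2 => h.disjoint i (hp.trans h1) (h2.trans hq), hcover,
    fun i h1 h2 => h.unique i (hp.trans h1) (h2.trans hq)⟩

/-- A boundary path may be shortened until both of its end blocks meet the boundary. -/
lemma exists_trim (h : G.BoundaryPath f p q U) : ∃ p' q', G.BoundaryPath f p' q' U ∧
    (p' ≤ q' → (∃ a ∈ G.boundary U, a ∈ f p') ∧ ∃ b ∈ G.boundary U, b ∈ f q') := by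
  generalize hn : (q + 1 - p).toNat = n
  induction n generalizing p q with
  | zero => exact ⟨p, q, h, fun _ => by lia⟩
  | succ n ih =>
    have hpq : p ≤ q := by lia
    by_cases ha : ∃ a ∈ G.boundary U, a ∈ f p
    · by_cases hb : ∃ b ∈ G.boundary U, b ∈ f q
      · exact ⟨p, q, h, fun _ => ⟨ha, hb⟩⟩
      · refine ih (h.mono (p' := p) (q' := q - 1) le_rfl (by lia) (by lia) fun x hx => ?_) (by lia)
        obtain ⟨i, h1, h2, h3⟩ := h.cover x hx
        have : i ≠ q := fun h => hb ⟨x, hx, h ▸ h3⟩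
        exact ⟨i, h1, by lia, h3⟩
    · refine ih (h.mono (p' := p + 1) (q' := q) (by lia) le_rfl (by lia) fun x hx => ?_) (by lia)
      obtain ⟨i, h1, h2, h3⟩ := h.cover x hx
      have : i ≠ p := fun h => ha ⟨x, hx, h ▸ h3⟩
      exact ⟨i, by lia, h2, h3⟩

/-- A boundary path of `U` is extended to one of a subset `W` of `U` whose boundary has at most one
new vertex. -/
lemma cons (h : G.BoundaryPath f p q U) {E : Set V} (hE : (G.induce E).Connected) (hEU : E ⊆ U)
    (hEp : p ≤ q → G.Touches E (f p)) (hWU : W ⊆ U) (hEW : Disjoint W E) (hc : c ∈ E)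
    (hbd : G.boundary W ⊆ insert c (G.boundary U)) :
    G.BoundaryPath (Function.update f (p - 1) E) (p - 1) q W := by
  have hne : ∀ i, p ≤ i → Function.update f (p - 1) E i = f i := fun i hi =>
    Function.update_of_ne (by lia) _ _
  have hcases : ∀ i, p - 1 ≤ i → i = p - 1 ∨ p ≤ i := fun i hi => by lia
  refine ⟨h.path.cons hE (fun i h1 h2 => (h.disjoint i h1 h2).mono_left hEU) hEp,
    by have := h.le; lia, fun i h1 h2 => ?_, fun x hx => ?_, fun i h1 h2 x hx y hy hxi hyi => ?_⟩
  · obtain rfl | h1 := hcases i h1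
    · rwa [Function.update_self]
    · rw [hne i h1]
      exact (h.disjoint i h1 h2).mono_left hWU
  · obtain rfl | hx := hbd hx
    · exact ⟨p - 1, le_rfl, by have := h.le; lia, by rwa [Function.update_self]⟩
    · obtain ⟨i, h1, h2, h3⟩ := h.cover x hx
      exact ⟨i, by lia, h2, by rwa [hne i h1]⟩
  · obtain rfl | h1 := hcases i h1
    · rw [Function.update_self] at hxi hyi
      have key : ∀ z ∈ G.boundary W, z ∈ E → z = c := fun z hz hzE =>
        (hbd hz).resolve_right fun hz => hz.1 (hEU hzE)
      rw [key x hx hxi, key y hy hyi]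
    · rw [hne i h1] at hxi hyi
      have key : ∀ z ∈ G.boundary W, z ∈ f i → z ∈ G.boundary U := fun z hz hzi =>
        (hbd hz).resolve_left fun hz =>
          Set.disjoint_left.1 (h.disjoint i h1 h2) (hEU hc) (hz ▸ hzi)
      exact h.unique i h1 h2 x (key x hx hxi) y (key y hy hyi) hxi hyi

/-- Extension to a component of `U \ {c}` that does not touch an attachment `a` in the first
block. -/
lemma exists_of_not_touches (h : G.BoundaryPath f p q U) (hU : (G.induce U).Connected)
    (ha : a ∈ G.boundary U) (hap : a ∈ f p) (hc : c ∈ U)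
    (hna : ¬ G.Touches (G.componentIn (U \ {c}) b) {a}) :
    ∃ f' p' q', G.BoundaryPath f' p' q' (G.componentIn (U \ {c}) b) := by
  have ⟨_, u, hu, e⟩ := ha
  set W := G.componentIn (U \ {c}) b
  have hW : W ⊆ U \ {c} := componentIn_subset
  have hcW : Disjoint W {c} := Set.disjoint_left.2 fun x hx => (hW hx).2
  obtain rfl | huc := eq_or_ne u c
  · exact ⟨_, _, _, h.cons (induce_singleton_connected u) (by simpa using hu)
      (fun _ => ⟨u, rfl, a, hap, e⟩) (hW.trans Set.sdiff_subset) hcW rfl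
      boundary_componentIn_diff_subset⟩
  have huU : u ∈ U \ {c} := ⟨hu, huc⟩
  set D := G.componentIn (U \ {c}) u
  have huD : u ∈ D := mem_componentIn_self huU
  have hDU : D ⊆ U := componentIn_subset.trans Set.sdiff_subset
  have hDW : Disjoint D W := disjoint_componentIn fun huW => hna ⟨u, huW, a, rfl, e⟩
  refine ⟨_, _, _, h.cons (E := insert c D)
    (insert_connected (componentIn_connected huU) (componentIn_diff_touches hU hu hc huc))
    (Set.insert_subset hc hDU) (fun _ => ⟨u, .inr huD, a, hap, e⟩) (hW.trans Set.sdiff_subset) ?_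
    (Set.mem_insert _ _) boundary_componentIn_diff_subset⟩
  rw [Set.insert_eq]
  exact hcW.union_right hDW.symm

end BoundaryPath

/-- A hub touching `k` blocks of a path whose end blocks are joined by another connected set. -/
lemma BlockPath.isMinor_wheel_of_touches {f : ℤ → Set V} {p q : ℤ} (h : G.BlockPath f p q)
    (hpq : p ≤ q) (hS : (G.induce S).Connected) (hT : (G.induce T).Connected) (hST : Disjoint S T)
    (hSf : ∀ i, p ≤ i → i ≤ q → Disjoint S (f i)) (hTf : ∀ i, p ≤ i → i ≤ q → Disjoint T (f i))
    (hTp : G.Touches T (f p)) (hTq : G.Touches T (f q)) {I : Finset ℤ}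
    (hI : ∀ i ∈ I, p ≤ i ∧ i ≤ q) (hSI : ∀ i ∈ I, G.Touches S (f i)) {k : ℕ} (hk : 0 < k)
    (hkI : k ≤ I.card) : IsMinor (wheel k) G := by
  have hne : ∀ i, p ≤ i → Function.update f (p - 1) T i = f i := fun i hi =>
    Function.update_of_ne (by lia) _ _
  refine (h.cons hT hTf fun _ => hTp).isMinor_wheel ?_ hS (fun i h1 h2 => ?_) (I := I)
    (fun i hi => ⟨by have := hI i hi; lia, (hI i hi).2⟩) (fun i hi => ?_) hk hkI
  · rw [hne q hpq, Function.update_self]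
    exact hTq.symm
  · obtain rfl | h1 := show i = p - 1 ∨ p ≤ i by lia
    · rwa [Function.update_self]
    · rw [hne i h1]
      exact hSf i h1 h2
  · rw [hne i (hI i hi).1]
    exact hSI i hi

namespace BoundaryPath

variable {f : ℤ → Set V} {p q : ℤ} {U : Set V}

lemma exists_card_eq [Finite V] (h : G.BoundaryPath f p q U) :
    ∃ I : Finset ℤ, (∀ i ∈ I, p ≤ i ∧ i ≤ q) ∧ (∀ i ∈ I, G.Touches U (f i)) ∧
      I.card = (G.boundary U).ncard := by
  choose! g hpg hgq hg using h.cover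
  have hfin : (g '' G.boundary U).Finite := Set.toFinite _
  refine ⟨hfin.toFinset, fun i hi => ?_, fun i hi => ?_, ?_⟩
  · obtain ⟨x, hx, rfl⟩ := hfin.mem_toFinset.1 hi
    exact ⟨hpg x hx, hgq x hx⟩
  · obtain ⟨x, hx, rfl⟩ := hfin.mem_toFinset.1 hi
    obtain ⟨-, u, hu, e⟩ := id hx
    exact ⟨u, hu, x, hg x hx, e⟩
  · rw [← Set.ncard_eq_toFinset_card _ hfin]
    refine Set.InjOn.ncard_image fun x hx y hy hxy => ?_
    exact h.unique (g x) (hpg x hx) (hgq x hx) x hx y hy (hg x hx) (hxy ▸ hg y hy)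

lemma isMinor_wheel [Finite V] (h : G.BoundaryPath f p q U) (hU : (G.induce U).Connected)
    (hpq : p ≤ q) (hap : a ∈ f p) (hbq : b ∈ f q) (hSU : S ⊆ U) (hTU : T ⊆ U)
    (hS : (G.induce S).Connected) (hT : (G.induce T).Connected) (hST : Disjoint S T)
    (hSa : G.Touches S {a}) (hSb : G.Touches S {b}) (hTa : G.Touches T {a}) (hTb : G.Touches T {b})
    {k : ℕ} (hk : 0 < k) (hcard : 2 * k ≤ (G.boundary U).ncard) : IsMinor (wheel k) G := by
  classical
  obtain ⟨S', T', hSS', hTT', rfl, hdis, hS', hT'⟩ :=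
    exists_connected_partition hU hS hT hSU hTU hST
  obtain ⟨I, hI, hUI, hIcard⟩ := h.exists_card_eq
  have hSf : ∀ i, p ≤ i → i ≤ q → Disjoint S' (f i) := fun i h1 h2 =>
    (h.disjoint i h1 h2).mono_left Set.subset_union_left
  have hTf : ∀ i, p ≤ i → i ≤ q → Disjoint T' (f i) := fun i h1 h2 =>
    (h.disjoint i h1 h2).mono_left Set.subset_union_right
  have ha : {a} ⊆ f p := by simpa using hap
  have hb : {b} ⊆ f q := by simpa using hbq
  have hunion : I ⊆ I.filter (fun i => G.Touches S' (f i)) ∪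
      I.filter (fun i => G.Touches T' (f i)) := fun i hi => by
    obtain ⟨u, hu | hu, hx⟩ := hUI i hi
    · exact Finset.mem_union_left _ (Finset.mem_filter.2 ⟨hi, u, hu, hx⟩)
    · exact Finset.mem_union_right _ (Finset.mem_filter.2 ⟨hi, u, hu, hx⟩)
  have hsum := (Finset.card_le_card hunion).trans (Finset.card_union_le _ _)
  obtain hk' | hk' : k ≤ (I.filter fun i => G.Touches S' (f i)).card ∨
      k ≤ (I.filter fun i => G.Touches T' (f i)).card := by lia
  · exact h.path.isMinor_wheel_of_touches hpq hS' hT' hdis hSf hTf (hTa.mono hTT' ha)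
      (hTb.mono hTT' hb) (fun i hi => hI i (Finset.mem_filter.1 hi).1)
      (fun i hi => (Finset.mem_filter.1 hi).2) hk hk'
  · exact h.path.isMinor_wheel_of_touches hpq hT' hS' hdis.symm hTf hSf (hSa.mono hSS' ha)
      (hSb.mono hSS' hb) (fun i hi => hI i (Finset.mem_filter.1 hi).1)
      (fun i hi => (Finset.mem_filter.1 hi).2) hk hk'

/-- Unless there is a wheel minor, `U` has a vertex whose removal leaves components that again have
boundary paths and small boundary. -/
lemma exists_vertex [Finite V] (h : G.BoundaryPath f p q U) (hU : (G.induce U).Connected) {k : ℕ}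
    (hk : 0 < k) (hcard : (G.boundary U).ncard ≤ 2 * k) (hG : ¬ IsMinor (wheel k) G) :
    ∃ c ∈ U, ∀ b ∈ U \ {c}, (∃ f' p' q', G.BoundaryPath f' p' q' (G.componentIn (U \ {c}) b)) ∧
      (G.boundary (G.componentIn (U \ {c}) b)).ncard ≤ 2 * k := by
  obtain ⟨p, q, h, hends⟩ := h.exists_trim
  obtain hlt | heq := hcard.lt_or_eq
  · obtain ⟨c, hc, hcp⟩ : ∃ c ∈ U, p ≤ q → G.Touches {c} (f p) := by
      by_cases hpq : p ≤ q
      · obtain ⟨⟨a, ⟨-, u, hu, e⟩, hap⟩, -⟩ := hends hpq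
        exact ⟨u, hu, fun _ => ⟨u, rfl, a, hap, e⟩⟩
      · obtain ⟨⟨u, hu⟩⟩ := hU.nonempty
        exact ⟨u, hu, fun h => absurd h hpq⟩
    refine ⟨c, hc, fun b hb => ⟨⟨_, _, _, h.cons (induce_singleton_connected c) (by simpa using hc)
      hcp (componentIn_subset.trans Set.sdiff_subset)
      (Set.disjoint_left.2 fun x hx => (componentIn_subset hx).2) rfl
      boundary_componentIn_diff_subset⟩, ?_⟩⟩
    have h1 := Set.ncard_le_ncard (boundary_componentIn_diff_subset (G := G) (S := U) (c := c)
      (b := b))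
    have h2 := Set.ncard_insert_le c (G.boundary U)
    lia
  have hpq : p ≤ q := by
    obtain ⟨x, hx⟩ : (G.boundary U).Nonempty := Set.nonempty_of_ncard_ne_zero (by lia)
    obtain ⟨i, h1, h2, -⟩ := h.cover x hx
    exact h1.trans h2
  obtain ⟨⟨a, ha, hap⟩, b, hb, hbq⟩ := hends hpq
  have hab : a ≠ b := by
    rintro rfl
    have hpq : p = q := by
      by_contra hne
      exact Set.disjoint_left.1 (h.path.disjoint p q le_rfl (by lia) le_rfl) hap hbq
    have hsub : G.boundary U ⊆ {a} := fun x hx => by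
      obtain ⟨i, h1, h2, hxi⟩ := h.cover x hx
      obtain rfl : i = p := by lia
      exact h.unique i h1 h2 x hx a ha hxi hap
    have := Set.ncard_le_ncard hsub
    rw [Set.ncard_singleton] at this
    lia
  have htou : ∀ x ∈ G.boundary U, G.Touches U {x} := fun x ⟨_, u, hu, e⟩ => ⟨u, hu, x, rfl, e⟩
  obtain ⟨c, hc, hsep⟩ | ⟨S, hSU, T, hTU, hS, hT, hST, hSa, hSb, hTa, hTb⟩ :=
    exists_separator_or_disjoint hU ha.1 hb.1 hab (htou a ha) (htou b hb)
  swap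
  · exact absurd (h.isMinor_wheel hU hpq hap hbq hSU hTU hS hT hST hSa hSb hTa hTb hk heq.ge) hG
  have hncard : ∀ x ∈ G.boundary U, ∀ z, ¬ G.Touches (G.componentIn (U \ {c}) z) {x} →
      (G.boundary (G.componentIn (U \ {c}) z)).ncard ≤ 2 * k := fun x hx z hxz => by
    have hsub : G.boundary (G.componentIn (U \ {c}) z) ⊆ insert c (G.boundary U \ {x}) :=
      fun y hy => (boundary_componentIn_diff_subset hy).imp id fun hyU => ⟨hyU, fun hyx => by
        obtain ⟨-, u, hu, e⟩ := hy
        exact hxz ⟨u, hu, y, hyx, e⟩⟩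
    have h1 := Set.ncard_le_ncard hsub
    have h2 := Set.ncard_insert_le c (G.boundary U \ {x})
    have h3 := Set.ncard_sdiff_singleton_add_one hx
    lia
  refine ⟨c, hc, fun z hz => ?_⟩
  obtain hna | hnb := not_and_or.1 (hsep _ componentIn_subset (componentIn_connected hz))
  · exact ⟨h.exists_of_not_touches hU ha hap hc hna, hncard a ha z hna⟩
  · exact ⟨h.reverse.exists_of_not_touches hU hb (by simpa using hbq) hc hnb, hncard b hb z hnb⟩

lemma hasTreeDecomposition [Finite V] {k : ℕ} (hk : 0 < k) (hG : ¬ IsMinor (wheel k) G)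
    (h : G.BoundaryPath f p q U) (hU : (G.induce U).Connected)
    (hcard : (G.boundary U).ncard ≤ 2 * k) :
    G.HasTreeDecomposition (2 * k + 1) (U ∪ G.boundary U) (G.boundary U) := by
  generalize hn : U.ncard = n
  induction n using Nat.strong_induction_on generalizing U f p q with
  | _ n ih =>
    obtain ⟨c, hc, hcomp⟩ := h.exists_vertex hU hk hcard hG
    have hcb : c ∉ G.boundary U := fun h => h.1 hc
    have hY : U ∪ G.boundary U = insert c (G.boundary U) ∪ U \ {c} := by
      ext x
      by_cases hxc : x = c
      · simp [hxc, hc]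
      · simp [hxc, or_comm]
    rw [hY]
    refine HasTreeDecomposition.mono_right (A := insert c (G.boundary U))
      (HasTreeDecomposition.of_components ((Set.ncard_insert_le _ _).trans (by lia)) ?_ ?_
        fun z hz => ?_) (Set.subset_insert _ _)
    · exact Set.disjoint_left.2 fun x hx hx' => hx'.elim hx.2 fun hx' => hx'.1 hx.1
    · rintro x ⟨hx, u, hu, e⟩
      by_cases hxc : x = c
      · exact .inl hxc
      · exact .inr ⟨fun hxU => hx ⟨hxU, hxc⟩, u, hu.1, e⟩
    · obtain ⟨⟨f', p', q', h'⟩, hcard'⟩ := hcomp z hz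
      refine ih _ ?_ h' (componentIn_connected hz) hcard' rfl
      rw [← hn]
      exact Set.ncard_lt_ncard ⟨componentIn_subset.trans Set.sdiff_subset,
        fun hsub => (componentIn_subset (hsub hc)).2 rfl⟩

end BoundaryPath

lemma treewidth_le_of_not_isMinor_wheel [Fintype V] {k : ℕ} (hk : 0 < k)
    (hG : ¬ IsMinor (wheel k) G) : treewidth G ≤ 2 * k := by
  have hbd : ∀ b, G.boundary (G.componentIn Set.univ b) = ∅ := fun b =>
    Set.eq_empty_of_forall_notMem fun _ hx => boundary_componentIn_subset hx (Set.mem_univ _)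
  have h : G.HasTreeDecomposition (2 * k + 1) (∅ ∪ Set.univ) ∅ := by
    refine HasTreeDecomposition.of_components (by simp) (Set.disjoint_empty _)
      (fun x hx => absurd (Set.mem_univ x) hx.1) fun b hb => ?_
    refine BoundaryPath.hasTreeDecomposition (f := fun _ => ∅) (p := 1) (q := 0) hk hG ?_
      (componentIn_connected hb) (by simp [hbd])
    exact ⟨⟨by lia, by lia, by lia⟩, by lia, by lia, by simp [hbd], by lia⟩
  rw [Set.empty_union] at h
  exact h.treewidth_le

end SimpleGraph

/-- If `tw(G) ≥ 36k - 5/2` then `G` contains the wheel of order `k` as a minor. -/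
theorem wheel_minor_of_treewidth {V : Type*} [Fintype V] (k : ℕ) (hk : 0 < k)
    (G : SimpleGraph V) (htw : (treewidth G : ℝ) ≥ 36 * k - 5 / 2) :
    IsMinor (wheel k) G := by
  by_contra hG
  have h : (treewidth G : ℝ) ≤ 2 * k := by
    exact_mod_cast SimpleGraph.treewidth_le_of_not_isMinor_wheel hk hG
  have hk' : (1 : ℝ) ≤ k := by exact_mod_cast hk
  linarith
end

section
/- Let h > 2 be an integer and let G be the graph formed as the union of the complete binary tree T = B_h and a path P on 2^h vertices, together with the edges {l, ψ(l)} for every leaf l of T, where ψ : L(T) → V(P) is a bijection. Then G contains the wheel of order 2^{h−2} + 1 as a minor. -/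
/-- The union of the complete binary tree of height `h` (vertices indexed in heap
order by `Fin (2^(h+1) - 1)`, the node `a` having children `2a+1` and `2a+2`, so the
leaves are the nodes of index `≥ 2^h - 1`, the leaf of rank `j : Fin (2^h)` being the
node `2^h - 1 + j`) and a path on `2^h` vertices, together with an edge between each
leaf of rank `j` and the path vertex `ψ j`, where `ψ` is a bijection from the leaves
of the tree onto the vertices of the path. -/
def wheelHost (h : ℕ) (ψ : Fin (2 ^ h) ≃ Fin (2 ^ h)) :
    SimpleGraph (Fin (2 ^ (h + 1) - 1) ⊕ Fin (2 ^ h)) :=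
  SimpleGraph.fromRel (fun u v =>
    match u, v with
    | Sum.inl a, Sum.inl b => (b : ℕ) = 2 * (a : ℕ) + 1 ∨ (b : ℕ) = 2 * (a : ℕ) + 2
    | Sum.inr i, Sum.inr j => (j : ℕ) = (i : ℕ) + 1
    | Sum.inl a, Sum.inr i => ∃ j : Fin (2 ^ h), (a : ℕ) = 2 ^ h - 1 + (j : ℕ) ∧ ψ j = i
    | _, _ => False)

/-- A set of vertices induces a connected subgraph as soon as each of its vertices other than a
fixed root has a neighbour in the set at which a given measure is smaller. -/
lemma connected_induce_of_descent {V : Type*} {G : SimpleGraph V} {X : Set V} {r : V}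
    (hr : r ∈ X) (μ : V → ℕ)
    (hd : ∀ v ∈ X, v ≠ r → ∃ w ∈ X, μ w < μ v ∧ G.Adj v w) :
    (G.induce X).Connected := by
  have key : ∀ n : ℕ, ∀ v (hv : v ∈ X), μ v = n → (G.induce X).Reachable ⟨v, hv⟩ ⟨r, hr⟩ := by
    intro n
    induction n using Nat.strong_induction_on with
    | _ n ih =>
      intro v hv hn
      by_cases hvr : v = r
      · subst hvr
        exact SimpleGraph.Reachable.refl _
      · obtain ⟨w, hw, hlt, hadj⟩ := hd v hv hvr
        have hstep : (G.induce X).Adj ⟨v, hv⟩ ⟨w, hw⟩ := hadj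
        exact hstep.reachable.trans (ih (μ w) (hn ▸ hlt) w hw rfl)
  rw [SimpleGraph.connected_iff_exists_forall_reachable]
  exact ⟨⟨r, hr⟩, fun v => (key _ v.1 v.2 rfl).symm⟩

/-- A strictly monotone map between finite linear orders of the form `Fin` has a monotone
left inverse. -/
lemma exists_monotone_leftInverse {N n : ℕ} (hN : 0 < N) {e : Fin N → Fin n}
    (he : StrictMono e) : ∃ f : Fin n → Fin N, Monotone f ∧ Function.LeftInverse f e := by
  let c : Fin n → ℕ := fun p => (Finset.univ.filter fun i => e i < p).card
  refine ⟨fun p => ⟨min (c p) (N - 1), by omega⟩, ?_, ?_⟩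
  · intro p p' hp
    have hc : c p ≤ c p' := by
      refine Finset.card_le_card fun i hi => ?_
      simp only [Finset.mem_filter, Finset.mem_univ, true_and] at hi ⊢
      exact hi.trans_le hp
    rw [Fin.mk_le_mk]
    omega
  · intro i
    have hc : c (e i) = i := by
      have hset : (Finset.univ.filter fun j => e j < e i) = Finset.Iio i := by
        ext j
        simp [he.lt_iff_lt]
      simp only [c, hset, Fin.card_Iio]
    ext
    have := i.2
    simp only [hc]
    omega

/-- A monotone map with a section takes consecutive values at some consecutive arguments. -/
lemma exists_consecutive_of_monotone {N n : ℕ} {e : Fin N → Fin n} {f : Fin n → Fin N}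
    (hf : Monotone f) (hfe : Function.LeftInverse f e) {i j : Fin N}
    (hij : (j : ℕ) = i + 1) :
    ∃ p q : Fin n, (q : ℕ) = p + 1 ∧ f p = i ∧ f q = j := by
  obtain ⟨p, hp, hmax⟩ := (Finset.univ.filter fun p => f p ≤ i).exists_max_image id
    ⟨e i, by simp [hfe i]⟩
  simp only [Finset.mem_filter, Finset.mem_univ, true_and, id] at hp hmax
  have hip : e i ≤ p := hmax _ (hfe i).le
  have hpj : p < e j := by
    by_contra hle
    have := hf (not_lt.mp hle)
    rw [hfe j] at this
    have := this.trans hp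
    rw [Fin.le_def] at this
    omega
  have hlt : (p : ℕ) + 1 < n := lt_of_le_of_lt hpj (e j).2
  refine ⟨p, ⟨p + 1, hlt⟩, rfl, le_antisymm hp ?_, le_antisymm ?_ ?_⟩
  · simpa [hfe i] using hf hip
  · have : (⟨p + 1, hlt⟩ : Fin n) ≤ e j := by
      rw [Fin.le_def]
      exact hpj
    simpa [hfe j] using hf this
  · by_contra hle
    have hle' : f ⟨p + 1, hlt⟩ ≤ i := by
      rw [Fin.le_def]
      rw [Fin.le_def] at hle
      omega
    have := hmax _ hle'
    rw [Fin.le_def] at this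
    simp at this

namespace wheelHost

variable {h : ℕ} {ψ : Fin (2 ^ h) ≃ Fin (2 ^ h)}

lemma adj_child {a b : Fin (2 ^ (h + 1) - 1)}
    (hab : (b : ℕ) = 2 * (a : ℕ) + 1 ∨ (b : ℕ) = 2 * (a : ℕ) + 2) :
    (wheelHost h ψ).Adj (Sum.inl a) (Sum.inl b) := by
  refine (SimpleGraph.fromRel_adj _ _ _).2 ⟨fun heq => ?_, Or.inl hab⟩
  rw [Sum.inl.inj heq] at hab
  omega

lemma adj_path {p q : Fin (2 ^ h)} (hpq : (q : ℕ) = p + 1) :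
    (wheelHost h ψ).Adj (Sum.inr p) (Sum.inr q) := by
  refine (SimpleGraph.fromRel_adj _ _ _).2 ⟨fun heq => ?_, Or.inl hpq⟩
  rw [Sum.inr.inj heq] at hpq
  omega

/-- The leaf of rank `j`. -/
def leaf (j : Fin (2 ^ h)) : Fin (2 ^ (h + 1) - 1) :=
  ⟨2 ^ h - 1 + j, by have := j.2; rw [pow_succ]; omega⟩

lemma adj_leaf (j : Fin (2 ^ h)) :
    (wheelHost h ψ).Adj (Sum.inl (leaf j)) (Sum.inr (ψ j)) :=
  (SimpleGraph.fromRel_adj _ _ _).2 ⟨Sum.inl_ne_inr, Or.inl ⟨j, rfl, rfl⟩⟩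

/-- `IsBelow g a` : in heap order, the node `a` lies in the subtree rooted at `g`. -/
def IsBelow (g a : ℕ) : Prop := ∃ k : ℕ, (a + 1) / 2 ^ k = g + 1

lemma isBelow_self (g : ℕ) : IsBelow g g := ⟨0, by simp⟩

lemma not_isBelow_of_lt {g a : ℕ} (hag : a < g) : ¬ IsBelow g a := by
  rintro ⟨k, hk⟩
  have := Nat.div_le_self (a + 1) (2 ^ k)
  omega

lemma isBelow_of_parent {g a b : ℕ} (hab : (a + 1) / 2 = b + 1) (hb : IsBelow g b) :
    IsBelow g a := by
  obtain ⟨k, hk⟩ := hb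
  exact ⟨k + 1, by rw [pow_succ', ← Nat.div_div_eq_div_mul, hab, hk]⟩

lemma IsBelow.parent {g a b : ℕ} (hab : (a + 1) / 2 = b + 1) (ha : IsBelow g a) (hne : a ≠ g) :
    IsBelow g b := by
  obtain ⟨k, hk⟩ := ha
  cases k with
  | zero => simp at hk; omega
  | succ k => exact ⟨k, by rw [← hk, pow_succ', ← Nat.div_div_eq_div_mul, hab]⟩

/-- The leaves below the `q`-th node at depth two are those of rank in the `q`-th quarter. -/
lemma isBelow_leaf_iff (hh : 2 ≤ h) {q : ℕ} (hq : q < 4) (j : Fin (2 ^ h)) :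
    IsBelow (q + 3) (leaf j : ℕ) ↔ (j : ℕ) / 2 ^ (h - 2) = q := by
  obtain ⟨m, rfl⟩ := Nat.exists_eq_add_of_le' hh
  have hpos : 0 < 2 ^ m := by positivity
  have hleaf : (leaf j : ℕ) + 1 = 2 ^ m * 4 + j := by
    simp only [leaf, pow_add]
    omega
  have hj : (j : ℕ) < 2 ^ m * 4 := by simpa [pow_add] using j.2
  have hdiv : ((leaf j : ℕ) + 1) / 2 ^ m = 4 + j / 2 ^ m := by
    rw [hleaf, Nat.mul_add_div hpos]
  have hj4 : (j : ℕ) / 2 ^ m < 4 := Nat.div_lt_of_lt_mul hj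
  rw [Nat.add_sub_cancel, IsBelow]
  generalize (j : ℕ) / 2 ^ m = s at hdiv hj4 ⊢
  clear hleaf hj hpos
  generalize (leaf j : ℕ) + 1 = t at hdiv ⊢
  clear j hh
  constructor
  · rintro ⟨k, hk⟩
    have hkm : k = m := by
      rcases lt_trichotomy k m with hlt | heq | hgt
      · obtain ⟨d, rfl⟩ := Nat.exists_eq_add_of_lt hlt
        rw [add_assoc, pow_add, ← Nat.div_div_eq_div_mul, hk, pow_succ',
          ← Nat.div_div_eq_div_mul] at hdiv
        have := Nat.div_le_self ((q + 3 + 1) / 2) (2 ^ d)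
        omega
      · exact heq
      · obtain ⟨d, rfl⟩ := Nat.exists_eq_add_of_lt hgt
        rw [add_assoc, pow_add, ← Nat.div_div_eq_div_mul, hdiv, pow_succ',
          ← Nat.div_div_eq_div_mul] at hk
        have := Nat.div_le_self ((4 + s) / 2) (2 ^ d)
        omega
    rw [hkm, hdiv] at hk
    omega
  · intro hjq
    exact ⟨m, by rw [hdiv]; omega⟩

/-- A set of tree nodes containing the parent of each of its members other than a fixed root
induces a connected subgraph. -/
lemma connected_induce_tree {X : Set (Fin (2 ^ (h + 1) - 1) ⊕ Fin (2 ^ h))}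
    {r : Fin (2 ^ (h + 1) - 1)} (hr : Sum.inl r ∈ X) (hX : ∀ p, Sum.inr p ∉ X)
    (hpar : ∀ a b : Fin (2 ^ (h + 1) - 1), Sum.inl a ∈ X → a ≠ r →
      ((a : ℕ) + 1) / 2 = b + 1 → Sum.inl b ∈ X)
    (hzero : ∀ a : Fin (2 ^ (h + 1) - 1), Sum.inl a ∈ X → a ≠ r → 0 < (a : ℕ)) :
    ((wheelHost h ψ).induce X).Connected := by
  refine connected_induce_of_descent hr (Sum.elim (fun a => (a : ℕ)) fun _ => 0) ?_
  rintro (a | p) hv hne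
  · have har : a ≠ r := fun heq => hne (by rw [heq])
    have ha := hzero a hv har
    have hlt := a.2
    refine ⟨Sum.inl ⟨((a : ℕ) - 1) / 2, by omega⟩, hpar a _ hv har ?_, ?_, ?_⟩
    · simp only
      omega
    · simp only [Sum.elim_inl]
      omega
    · refine (adj_child ?_).symm
      simp only
      omega
  · exact absurd hv (hX p)

/-- A nonempty fibre of a monotone map on the path induces a connected subgraph. -/
lemma connected_induce_path {N : ℕ} {X : Set (Fin (2 ^ (h + 1) - 1) ⊕ Fin (2 ^ h))}
    {f : Fin (2 ^ h) → Fin N} (hf : Monotone f) {r : Fin (2 ^ h)}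
    (hX : ∀ a, Sum.inl a ∉ X) (hXf : ∀ p, Sum.inr p ∈ X ↔ f p = f r) :
    ((wheelHost h ψ).induce X).Connected := by
  refine connected_induce_of_descent (r := Sum.inr r) ((hXf r).2 rfl)
    (Sum.elim (fun _ => 0) fun p => ((p : ℕ) - r) + (r - p)) ?_
  rintro (a | p) hv hne
  · exact absurd hv (hX a)
  · have hpr : p ≠ r := fun heq => hne (by rw [heq])
    rw [hXf] at hv
    have hp := p.2
    rcases lt_or_gt_of_ne hpr with hlt | hgt
    · rw [Fin.lt_def] at hlt
      have hb : (p : ℕ) + 1 < 2 ^ h := by have := r.2; omega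
      refine ⟨Sum.inr ⟨p + 1, hb⟩, (hXf _).2 (le_antisymm ?_ ?_), ?_, adj_path rfl⟩
      · exact hf (by rw [Fin.le_def]; exact hlt)
      · rw [← hv]
        exact hf (by rw [Fin.le_def]; simp)
      · simp only [Sum.elim_inr]
        omega
    · rw [Fin.lt_def] at hgt
      have hb : (p : ℕ) - 1 < 2 ^ h := by omega
      refine ⟨Sum.inr ⟨p - 1, hb⟩, (hXf _).2 (le_antisymm ?_ ?_), ?_, (adj_path ?_).symm⟩
      · rw [← hv]
        exact hf (by rw [Fin.le_def]; simp)
      · exact hf (by rw [Fin.le_def]; simp only; omega)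
      · simp only [Sum.elim_inr]
        omega
      · simp only
        omega

end wheelHost

/-- To exhibit a wheel minor, it suffices to label all vertices so that the label classes are
connected and have the required edges between them. -/
lemma isMinor_wheel_of_labelling {V : Type*} {G : SimpleGraph V} {N : ℕ} (hN : 0 < N)
    (col : V → Option (Fin (N + 1)))
    (hconn : ∀ c, (G.induce {v | col v = c}).Connected)
    (hub : ∀ i, ∃ a b, col a = none ∧ col b = some i ∧ G.Adj a b)
    (hstep : ∀ i j : Fin N, (j : ℕ) = i + 1 →
      ∃ a b, col a = some i.castSucc ∧ col b = some j.castSucc ∧ G.Adj a b)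
    (hfirst : ∃ a b, col a = some (Fin.last N) ∧ col b = some 0 ∧ G.Adj a b)
    (hlast : ∃ a b, col a = some (Fin.last N) ∧
      col b = some (Fin.castSucc ⟨N - 1, by omega⟩) ∧ G.Adj a b) :
    IsMinor (wheel (N + 1)) G := by
  have hrim : ∀ i j : Fin (N + 1), (j : ℕ) = ((i : ℕ) + 1) % (N + 1) →
      ∃ a b, col a = some i ∧ col b = some j ∧ G.Adj a b := by
    intro i j hij
    induction i using Fin.lastCases with
    | last =>
      obtain rfl : j = 0 := by
        ext
        simpa using hij
      exact hfirst
    | cast i =>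
      have hi := i.2
      rw [Fin.val_castSucc, Nat.mod_eq_of_lt (by omega)] at hij
      induction j using Fin.lastCases with
      | last =>
        obtain ⟨a, b, ha, hb, hab⟩ := hlast
        have hi_eq : i = ⟨N - 1, by omega⟩ := by
          ext
          simp only [Fin.val_last] at hij ⊢
          omega
        rw [hi_eq]
        exact ⟨b, a, hb, ha, hab.symm⟩
      | cast j => exact hstep i j hij
  refine ⟨fun c => {v | col v = c}, hconn, ?_, ?_⟩
  · intro c d hcd
    exact Set.disjoint_left.2 fun v hv hv' => hcd (hv.symm.trans hv')
  · rintro (_ | i) (_ | j) hadj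
    · exact absurd rfl hadj.ne
    · obtain ⟨a, b, ha, hb, hab⟩ := hub j
      exact ⟨a, ha, b, hb, hab⟩
    · obtain ⟨a, b, ha, hb, hab⟩ := hub i
      exact ⟨b, hb, a, ha, hab.symm⟩
    · rcases ((SimpleGraph.fromRel_adj _ _ _).1 hadj).2 with hij | hij
      · obtain ⟨a, b, ha, hb, hab⟩ := hrim i j hij
        exact ⟨a, ha, b, hb, hab⟩
      · obtain ⟨a, b, ha, hb, hab⟩ := hrim j i hij
        exact ⟨b, hb, a, ha, hab.symm⟩

open wheelHost in
/-- For `h > 2`, the union of the complete binary tree `B_h` and a path on `2^h`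
vertices, linked by a perfect matching between the leaves of the tree and the
vertices of the path, contains the wheel of order `2^(h-2) + 1` as a minor. -/
theorem wheel_minor_of_wheelHost (h : ℕ) (hh : 2 < h) (ψ : Fin (2 ^ h) ≃ Fin (2 ^ h)) :
    IsMinor (wheel (2 ^ (h - 2) + 1)) (wheelHost h ψ) := by
  classical
  have hpow : 2 ^ h = 2 ^ (h - 2) * 4 := by
    rw [show (4 : ℕ) = 2 ^ 2 by norm_num, ← pow_add, Nat.sub_add_cancel hh.le]
  have hN : 0 < 2 ^ (h - 2) := by positivity
  have hsize : 2 ^ (h + 1) - 1 = 2 ^ (h - 2) * 8 - 1 := by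
    rw [pow_succ, hpow]
    omega
  set N := 2 ^ (h - 2)
  let first : Fin (2 ^ h) := ⟨0, by omega⟩
  let last : Fin (2 ^ h) := ⟨2 ^ h - 1, by omega⟩
  obtain ⟨q, hq, hqf, hql⟩ : ∃ q < 4, (ψ.symm first : ℕ) / N ≠ q ∧ (ψ.symm last : ℕ) / N ≠ q := by
    generalize (ψ.symm first : ℕ) / N = x
    generalize (ψ.symm last : ℕ) / N = y
    by_contra! hcon
    have h0 := hcon 0
    have h1 := hcon 1
    have h2 := hcon 2
    omega
  have hrank : ∀ t : Fin N, q * N + t < 2 ^ h := fun t => by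
    have := t.2
    have : q * N ≤ 3 * N := Nat.mul_le_mul_right N (by omega)
    omega
  let rank : Fin N → Fin (2 ^ h) := fun t => ⟨q * N + t, hrank t⟩
  have hrank_div : ∀ t, (rank t : ℕ) / N = q := fun t => by
    simp only [rank]
    rw [mul_comm, Nat.mul_add_div hN, Nat.div_eq_of_lt t.2, add_zero]
  have hinj : Function.Injective fun t => ψ (rank t) := by
    refine ψ.injective.comp fun s t hst => ?_
    simpa [rank, Fin.ext_iff] using hst
  have hcard : (Finset.univ.image fun t => ψ (rank t)).card = N := by
    rw [Finset.card_image_of_injective _ hinj, Finset.card_univ, Fintype.card_fin]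
  let e : Fin N → Fin (2 ^ h) := Finset.orderEmbOfFin _ hcard
  have he : StrictMono e := (Finset.orderEmbOfFin _ hcard).strictMono
  have hmem : ∀ i, ∃ t, ψ (rank t) = e i := fun i => by
    obtain ⟨t, -, ht⟩ := Finset.mem_image.1 (Finset.orderEmbOfFin_mem _ hcard i)
    exact ⟨t, ht⟩
  obtain ⟨f, hf, hfe⟩ := exists_monotone_leftInverse hN he
  have hsmall : ∀ {a : ℕ}, a ≤ 6 → a < 2 ^ (h + 1) - 1 := fun {a} ha => by omega
  let col : Fin (2 ^ (h + 1) - 1) ⊕ Fin (2 ^ h) → Option (Fin (N + 1)) :=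
    Sum.elim (fun a => if IsBelow (q + 3) a then none else some (Fin.last N))
      fun p => some (f p).castSucc
  have hcol_none : ∀ a, col (Sum.inl a) = none ↔ IsBelow (q + 3) a := by simp [col]
  have hcol_last : ∀ a, col (Sum.inl a) = some (Fin.last N) ↔ ¬ IsBelow (q + 3) a := by simp [col]
  have hcol_path : ∀ p, col (Sum.inr p) = some (f p).castSucc := fun _ => rfl
  have hcol_cast : ∀ a (i : Fin N), col (Sum.inl a) ≠ some i.castSucc := by
    intro a i
    simp only [col, Sum.elim_inl]
    split_ifs
    · simp
    · simpa using (Fin.castSucc_lt_last i).ne'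
  have hend : ∀ p, (ψ.symm p : ℕ) / N ≠ q →
      ∃ a b, col a = some (Fin.last N) ∧ col b = some (f p).castSucc ∧ (wheelHost h ψ).Adj a b := by
    intro p hp
    refine ⟨Sum.inl (leaf (ψ.symm p)), Sum.inr p, ?_, rfl, ?_⟩
    · rw [hcol_last, isBelow_leaf_iff hh.le hq]
      exact hp
    · simpa using adj_leaf (ψ := ψ) (ψ.symm p)
  refine isMinor_wheel_of_labelling hN col ?_ ?_ ?_ ?_ ?_
  · rintro (_ | i)
    · refine connected_induce_tree (r := ⟨q + 3, hsmall (by omega)⟩) ?_ ?_ ?_ ?_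
      · exact (hcol_none _).2 (isBelow_self _)
      · simp [hcol_path]
      · intro a b ha hne hab
        exact (hcol_none _).2 (((hcol_none _).1 ha).parent hab fun heq => hne (Fin.ext heq))
      · intro a ha _
        by_contra hza
        exact not_isBelow_of_lt (by omega) ((hcol_none _).1 ha)
    · induction i using Fin.lastCases with
      | last =>
        refine connected_induce_tree (r := ⟨0, hsmall (by omega)⟩) ?_ ?_ ?_ ?_
        · exact (hcol_last _).2 (not_isBelow_of_lt (by simp))
        · intro p
          simp [hcol_path]
        · intro a b ha _ hab
          exact (hcol_last _).2 fun hb => (hcol_last _).1 ha (isBelow_of_parent hab hb)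
        · intro a _ hne
          exact Nat.pos_of_ne_zero fun heq => hne (Fin.ext heq)
      | cast i =>
        refine connected_induce_path hf (r := e i) (fun a => hcol_cast a i) fun p => ?_
        rw [hfe i]
        simp [hcol_path]
  · intro i
    induction i using Fin.lastCases with
    | last =>
      refine ⟨Sum.inl ⟨q + 3, hsmall (by omega)⟩, Sum.inl ⟨(q + 2) / 2, hsmall (by omega)⟩,
        (hcol_none _).2 (isBelow_self _),
        (hcol_last _).2 (not_isBelow_of_lt (by simp only; omega)), (adj_child ?_).symm⟩
      simp only
      omega
    | cast i =>
      obtain ⟨t, ht⟩ := hmem i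
      refine ⟨Sum.inl (leaf (rank t)), Sum.inr (ψ (rank t)), ?_, ?_, adj_leaf _⟩
      · rw [hcol_none, isBelow_leaf_iff hh.le hq]
        exact hrank_div t
      · rw [hcol_path, ht, hfe i]
  · intro i j hij
    obtain ⟨p, p', hpp, hp, hp'⟩ := exists_consecutive_of_monotone hf hfe hij
    exact ⟨Sum.inr p, Sum.inr p', by rw [hcol_path, hp], by rw [hcol_path, hp'], adj_path hpp⟩
  · have hfirst : (f first).castSucc = 0 := by
      have := hf (show first ≤ e ⟨0, hN⟩ by simp [first])
      rw [hfe, Fin.le_def] at this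
      ext
      simpa using this
    simpa only [hfirst] using hend first hqf
  · have hlast : f last = ⟨N - 1, by omega⟩ := by
      have := hf (show e ⟨N - 1, by omega⟩ ≤ last by
        have := (e ⟨N - 1, by omega⟩).2
        simp only [last, Fin.le_def]
        omega)
      rw [hfe, Fin.le_def] at this
      have hlt := (f last).2
      ext
      simp only at this ⊢
      omega
    simpa only [hlast] using hend last hql
end
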